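/- For all integers k ≥ i ≥ 1 and all nonnegative integers n, j, N, the number of paths with major index n, j South steps, and exactly N peaks satisfying the special (k,i)-conditions equals the number of overpartitions counted by B̄_{k,i}(n,j) whose multiplicity sequence has length N. -/

import Mathlib

namespace Paper

/-- The four kinds of unitary steps. -/
inductive PStep : Type
  | NE | SE | S | E
  deriving DecidableEq, BEq, Repr

/-- Horizontal displacement of a step. -/
def stepDx : PStep → ℕ
  | .S => 0
  | _ => 1

/-- Vertical displacement of a step. -/
def stepDy : PStep → ℤ
  | .NE => 1
  | .SE => -1
  | .S => -1
  | .E => 0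

/-- Height (`y`-coordinate) after performing the steps of `l`, starting at height `h`. -/
def pathHeight (h : ℕ) (l : List PStep) : ℤ := (h : ℤ) + (l.map stepDy).sum

/-- `x`-coordinate after performing the steps of `l`, starting on the `y`-axis. -/
def pathX (l : List PStep) : ℕ := (l.map stepDx).sum

/-- A valid path: stays in the first quadrant, starts at `(0,h)` on the `y`-axis, ends
on the `x`-axis, South steps only appear directly after a North-East step, East steps
only appear at height `0`, and the path is empty or ends with a South-East or South step. -/
def ValidPath (h : ℕ) (l : List PStep) : Prop :=
  (∀ m : ℕ, 0 ≤ pathHeight h (l.take m)) ∧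
  (∀ m : ℕ, l[m]? = some PStep.S → ∃ m', m = m' + 1 ∧ l[m']? = some PStep.NE) ∧
  (∀ m : ℕ, l[m]? = some PStep.E → pathHeight h (l.take m) = 0) ∧
  pathHeight h l = 0 ∧
  (l = [] ∨ l.getLast? = some PStep.SE ∨ l.getLast? = some PStep.S)

/-- The vertex reached after step `m` is a peak: it is preceded by a North-East step and
followed by a South-East step (NESE peak) or a South step (NES peak). -/
def IsPeak (l : List PStep) (m : ℕ) : Prop :=
  l[m]? = some PStep.NE ∧ (l[m+1]? = some PStep.SE ∨ l[m+1]? = some PStep.S)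

instance (l : List PStep) (m : ℕ) : Decidable (IsPeak l m) := by
  unfold IsPeak; infer_instance

/-- The major index of a path: the sum of the `x`-coordinates of its peaks. -/
def majorIndex (l : List PStep) : ℕ :=
  ∑ m ∈ Finset.range l.length, if IsPeak l m then pathX (l.take (m + 1)) else 0

/-- The number of peaks of a path. -/
def numPeaks (l : List PStep) : ℕ :=
  ((Finset.range l.length).filter fun m => IsPeak l m).card

/-- The number of South steps of a path. -/
def southSteps (l : List PStep) : ℕ := l.count PStep.S

/-- A path satisfies the special `(k,i)`-conditions if it is a valid path starting at
height `k - i` whose height always stays below `k`. -/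
def SpecialPath (k i : ℕ) (l : List PStep) : Prop :=
  ValidPath (k - i) l ∧ ∀ m : ℕ, pathHeight (k - i) (l.take m) < k

/-- `Ebar k i n j` is the number of paths with major index `n` and `j` South steps
satisfying the special `(k,i)`-conditions. -/
noncomputable def Ebar (k i n j : ℕ) : ℕ :=
  Nat.card {l : List PStep // SpecialPath k i l ∧ majorIndex l = n ∧ southSteps l = j}


/-- An overpartition is represented as a list of pairs `(part, overlined?)`.
Parts are positive, the list is non-increasing in the part sizes, and among
equal parts only the final occurrence may be overlined. -/
def IsOverpartition (l : List (ℕ × Bool)) : Prop :=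
  (∀ p ∈ l, 1 ≤ p.1) ∧
  l.Chain' fun x y => y.1 < x.1 ∨ (x.1 = y.1 ∧ x.2 = false)

/-- The weight of an overpartition: the sum of its parts. -/
def opWeight (l : List (ℕ × Bool)) : ℕ := (l.map Prod.fst).sum

/-- The number of overlined parts. -/
def opOverlined (l : List (ℕ × Bool)) : ℕ := (l.filter fun p => p.2).length

/-- The difference condition of Gordon type: `λ_ℓ - λ_{ℓ+k-1} ≥ 1` if `λ_{ℓ+k-1}` is
overlined and `λ_ℓ - λ_{ℓ+k-1} ≥ 2` otherwise (indices `0`-based). -/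
def GapCond (k : ℕ) (l : List (ℕ × Bool)) : Prop :=
  ∀ m : ℕ, m + (k - 1) < l.length →
    (l.getD (m + (k - 1)) (0, false)).1 +
      (if (l.getD (m + (k - 1)) (0, false)).2 then 1 else 2) ≤ (l.getD m (0, false)).1

/-- Overpartitions counted by `B̄_{k,i}`: the Gordon difference condition holds and at
most `i - 1` parts are equal to `1`. -/
def BCond (k i : ℕ) (l : List (ℕ × Bool)) : Prop :=
  IsOverpartition l ∧ GapCond k l ∧ (l.filter fun p => p.1 == 1).length ≤ i - 1

/-- `Bbar k i n j` : the number of overpartitions of `n` with `j` overlined parts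
satisfying the `B̄_{k,i}` conditions. -/
noncomputable def Bbar (k i n j : ℕ) : ℕ :=
  Nat.card {l : List (ℕ × Bool) //
    BCond k i l ∧ opWeight l = n ∧ opOverlined l = j}

/-- The Frobenius representation of an overpartition: a two-rowed array whose top row
is a partition into distinct nonnegative parts and whose bottom row is an
overpartition into nonnegative parts where the first occurrence of a part may be
overlined. -/
structure FrobSym : Type where
  top : List ℕ
  bot : List (ℕ × Bool)
  top_sorted : top.Chain' (· > ·)
  bot_sorted : bot.Chain' fun x y => y.1 < x.1 ∨ (x.1 = y.1 ∧ y.2 = false)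
  len_eq : top.length = bot.length

/-- The number of columns of a Frobenius symbol. -/
def frobCols (F : FrobSym) : ℕ := F.top.length

/-- The weight of the overpartition represented by a Frobenius symbol. -/
def frobWeight (F : FrobSym) : ℕ :=
  F.top.length + F.top.sum + (F.bot.map Prod.fst).sum

/-- The number of non-overlined parts in the bottom row. -/
def botNonOverlined (F : FrobSym) : ℕ := (F.bot.filter fun p => !p.2).length

/-- The number of overlined parts in the bottom row. -/
def botOverlined (F : FrobSym) : ℕ := (F.bot.filter fun p => p.2).length

/-- The `m`-th successive rank (0-based): `a_m - b_m` minus the number of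
non-overlined parts among `b_{m+1}, …, b_N`. -/
def frobRank (F : FrobSym) (m : ℕ) : ℤ :=
  (F.top.getD m 0 : ℤ) - ((F.bot.getD m (0, false)).1 : ℤ) -
    (((F.bot.drop (m + 1)).filter fun p => !p.2).length : ℤ)

/-- All successive ranks lie in the interval `[-i+2, 2k-i-1]`. -/
def RankCond (k i : ℕ) (F : FrobSym) : Prop :=
  ∀ m : ℕ, m < F.top.length →
    -(i : ℤ) + 2 ≤ frobRank F m ∧ frobRank F m ≤ 2 * (k : ℤ) - i - 1

/-- `Cbar k i n j` : the number of overpartitions of `n` (counted through their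
Frobenius representation) with `j` non-overlined parts in the bottom row and all
successive ranks in `[-i+2, 2k-i-1]`. -/
noncomputable def Cbar (k i n j : ℕ) : ℕ :=
  Nat.card {F : FrobSym //
    frobWeight F = n ∧ botNonOverlined F = j ∧ RankCond k i F}

/-- The list of overlined parts (in order). -/
def olList (l : List (ℕ × Bool)) : List ℕ := (l.filter fun p => p.2).map Prod.fst

/-- The list of non-overlined parts (in order). -/
def nolList (l : List (ℕ × Bool)) : List ℕ := (l.filter fun p => !p.2).map Prod.fst

/-- The size of the generalized Durfee square: the largest `N` such that the number of
overlined parts plus the number of non-overlined parts `≥ N` is at least `N`. -/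
noncomputable def genDurfeeSize (l : List (ℕ × Bool)) : ℕ :=
  Nat.findGreatest
    (fun N => N ≤ (olList l).length + ((nolList l).filter fun p => decide (N ≤ p)).length)
    l.length

/-- The size of the generalized Durfee rectangle: the largest `N` such that the number
of overlined parts plus the number of non-overlined parts `≥ N + 1` is at least `N`. -/
noncomputable def genDurfeeRectSize (l : List (ℕ × Bool)) : ℕ :=
  Nat.findGreatest
    (fun N => N ≤ (olList l).length + ((nolList l).filter fun p => decide (N + 1 ≤ p)).length)
    l.length

/-- The (ordinary) partition lying below the first generalized Durfee square/rectangle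
of size `N`, when the overlined parts are displayed above the non-overlined ones. -/
def belowGen (l : List (ℕ × Bool)) (N : ℕ) : List ℕ :=
  (nolList l).drop (N - (olList l).length)

/-- The size of the Durfee square of an ordinary partition. -/
noncomputable def durfeeSquareSize (μ : List ℕ) : ℕ :=
  Nat.findGreatest (fun d => d ≤ (μ.filter fun p => decide (d ≤ p)).length) μ.length

/-- The size of the `d × (d+1)` Durfee rectangle of an ordinary partition. -/
noncomputable def durfeeRectSize (μ : List ℕ) : ℕ :=
  Nat.findGreatest (fun d => d ≤ (μ.filter fun p => decide (d + 1 ≤ p)).length) μ.length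

/-- Remove `m` successive Durfee squares. -/
noncomputable def dissectSquares : ℕ → List ℕ → List ℕ
  | 0, μ => μ
  | m + 1, μ => dissectSquares m (μ.drop (durfeeSquareSize μ))

/-- Remove `m` successive Durfee rectangles. -/
noncomputable def dissectRects : ℕ → List ℕ → List ℕ
  | 0, μ => μ
  | m + 1, μ => dissectRects m (μ.drop (durfeeRectSize μ))

/-- The overpartition has `i - 1` successive Durfee squares followed by `k - i`
successive Durfee rectangles, the first one being a generalized
Durfee square (if `i ≥ 2`) or a generalized Durfee rectangle (if `i = 1`). -/
noncomputable def DurfeeCond (k i : ℕ) (l : List (ℕ × Bool)) : Prop :=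
  if 2 ≤ i then
    dissectRects (k - i) (dissectSquares (i - 2) (belowGen l (genDurfeeSize l))) = []
  else
    dissectRects (k - 2) (belowGen l (genDurfeeRectSize l)) = []

/-- `Dbar k i n j` : the number of overpartitions of `n` with `j` overlined parts and
`i-1` successive Durfee squares followed by `k-i` successive Durfee rectangles, the
first one being a generalized Durfee square/rectangle. -/
noncomputable def Dbar (k i n j : ℕ) : ℕ :=
  Nat.card {l : List (ℕ × Bool) //
    IsOverpartition l ∧ opWeight l = n ∧ opOverlined l = j ∧ DurfeeCond k i l}


mutual
  /-- Auxiliary: scanning the multiplicity list from the largest part downwards,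
  looking for the (positive) right end of the next multuple. -/
  def msLenAux : List (ℕ × Bool) → ℕ
    | [] => 0
    | x :: xs => if 0 < x.1 then 1 + msLenWalk xs else msLenAux xs

  /-- Auxiliary: walking leftwards through the overlined multiplicities inside a
  multuple until its non-overlined left end is found. -/
  def msLenWalk : List (ℕ × Bool) → ℕ
    | [] => 0
    | x :: xs => if x.2 then 1 + msLenWalk xs else msLenAux xs
end

/-- The length of the multiplicity sequence of an overpartition: the sum of the
lengths of the multuples obtained by dividing the multiplicity sequence from right
to left. -/
def msLength (l : List (ℕ × Bool)) : ℕ :=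
  let M := (l.map Prod.fst).foldr max 0
  msLenAux (((List.range (M + 1)).reverse).map fun v =>
    ((l.filter fun p => p.1 == v).length, l.contains (v, true)))


/-! ### Moving parts one position to the left in a multiplicity sequence

The multiplicity of a part is recorded as `(u, o)`, where `u` is the number of non-overlined
occurrences and `o` tells whether there is an overlined one. -/

/-- What a right-to-left scan of a multiplicity sequence carries across a position: nothing
outside the multuples, and a plain or an overlined part inside them. -/
inductive Carry : Type
  | none | plain | bar

/-- The number of parts carried. -/
def Carry.size : Carry → ℕ
  | .none => 0
  | _ => 1

/-- The number of overlined parts carried. -/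
def Carry.bars : Carry → ℕ
  | .bar => 1
  | _ => 0

/-- The total multiplicity. -/
def mult (x : ℕ × Bool) : ℕ := x.1 + x.2.toNat

/-- One step of the right-to-left scan: from the carry on the right and the old multiplicity
to the carry on the left and the new multiplicity. -/
def push : Carry → ℕ × Bool → Carry × (ℕ × Bool)
  | .none, (0, false) => (.none, (0, false))
  | .none, (0, true) => (.bar, (0, false))
  | .none, (a + 1, o) => (.plain, (a, o))
  | .plain, (a, false) => (.none, (a + 1, false))
  | .plain, (a, true) => (.bar, (a + 1, false))
  | .bar, (a, false) => (.none, (a, true))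
  | .bar, (a, true) => (.bar, (a, true))

/-- The inverse of `push`. -/
def pull : Carry → ℕ × Bool → Carry × (ℕ × Bool)
  | .none, (0, false) => (.none, (0, false))
  | .none, (a + 1, false) => (.plain, (a, false))
  | .none, (a, true) => (.bar, (a, false))
  | .plain, (a, o) => (.none, (a + 1, o))
  | .bar, (0, false) => (.none, (0, true))
  | .bar, (a + 1, false) => (.plain, (a, true))
  | .bar, (a, true) => (.bar, (a, true))

theorem push_pull (s : Carry) (y : ℕ × Bool) : push (pull s y).1 (pull s y).2 = (s, y) := by
  rcases s <;> rcases y with ⟨_ | a, _ | _⟩ <;> rfl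

theorem pull_push (s : Carry) (x : ℕ × Bool) : pull (push s x).1 (push s x).2 = (s, x) := by
  rcases s <;> rcases x with ⟨_ | a, _ | _⟩ <;> rfl

/-- The multiplicity sequence whose right-to-left scan produces `y` with final carry `s`. -/
def raise : Carry → List (ℕ × Bool) → List (ℕ × Bool)
  | .none, [] => []
  | .plain, [] => [(1, false)]
  | .bar, [] => [(0, true)]
  | s, y :: ys => (pull s y).2 :: raise (pull s y).1 ys

theorem raise_cons (s : Carry) (y : ℕ × Bool) (ys : List (ℕ × Bool)) :
    raise s (y :: ys) = (pull s y).2 :: raise (pull s y).1 ys := by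
  cases s <;> rfl

/-- The carry left over at the end of the right-to-left scan. -/
def carryOf : List (ℕ × Bool) → Carry
  | [] => .none
  | x :: xs => (push (carryOf xs) x).1

/-- The sum of the lengths of the multuples. -/
def blockLength : List (ℕ × Bool) → ℕ
  | [] => 0
  | x :: xs => blockLength xs + (push (carryOf xs) x).1.size

/-- The number of parts. -/
def partCount : List (ℕ × Bool) → ℕ
  | [] => 0
  | x :: xs => mult x + partCount xs

/-- The sum of the parts. -/
def weight : List (ℕ × Bool) → ℕ
  | [] => 0
  | x :: xs => mult x + (weight xs + partCount xs)

/-- The number of overlined parts. -/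
def barCount : List (ℕ × Bool) → ℕ
  | [] => 0
  | x :: xs => x.2.toNat + barCount xs

/-- A multiplicity sequence without trailing zeros. -/
def Trimmed : List (ℕ × Bool) → Prop
  | [] => True
  | x :: xs => Trimmed xs ∧ (xs = [] → x ≠ (0, false))

/-- The difference condition on a multiplicity sequence preceded by `h` non-overlined
parts. -/
def Gap (K : ℕ) : ℕ → List (ℕ × Bool) → Prop
  | h, [] => h ≤ K
  | h, x :: xs => h + mult x ≤ K ∧ Gap K x.1 xs

theorem Gap.le {K h : ℕ} {x : List (ℕ × Bool)} (hx : Gap K h x) : h ≤ K := by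
  cases x with
  | nil => exact hx
  | cons a x => have := hx.1; omega

theorem carryOf_raise (s : Carry) (y : List (ℕ × Bool)) : carryOf (raise s y) = s := by
  induction y generalizing s with
  | nil => cases s <;> rfl
  | cons a y ih => simp [raise, carryOf, ih, push_pull]

theorem raise_none_eq_nil {s : Carry} {y : List (ℕ × Bool)} (h : raise s y = []) :
    s = .none ∧ y = [] := by
  cases y with
  | nil => cases s <;> simp_all [raise]
  | cons a y => simp [raise] at h

theorem trimmed_raise (s : Carry) {y : List (ℕ × Bool)} (hy : Trimmed y) :
    Trimmed (raise s y) := by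
  induction y generalizing s with
  | nil => cases s <;> simp [raise, Trimmed]
  | cons a y ih =>
    rw [raise_cons]
    refine ⟨ih _ hy.1, fun h0 hx => ?_⟩
    obtain ⟨h1, h2⟩ := raise_none_eq_nil h0
    have := push_pull s a
    rw [h1, hx] at this
    exact hy.2 h2 (congrArg Prod.snd this).symm

theorem raise_injective {s s' : Carry} {y y' : List (ℕ × Bool)} (hy : Trimmed y)
    (hy' : Trimmed y') (h : raise s y = raise s' y') : s = s' ∧ y = y' := by
  have hs : s = s' := by rw [← carryOf_raise s y, h, carryOf_raise]
  refine ⟨hs, ?_⟩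
  subst hs
  have key : ∀ (s : Carry) (a : ℕ × Bool) (z : List (ℕ × Bool)), Trimmed (a :: z) →
      raise s [] ≠ raise s (a :: z) := by
    intro s a z hz he
    rw [raise.eq_def s (a :: z)] at he
    have hp := push_pull s a
    cases s <;> simp only [raise] at he
    · simp at he
    all_goals
      obtain ⟨h1, h2⟩ := List.cons.inj he
      obtain ⟨h3, h4⟩ := raise_none_eq_nil h2.symm
      rw [← h1, h3] at hp
      exact hz.2 h4 (congrArg Prod.snd hp).symm
  induction y generalizing s y' with
  | nil =>
    cases y' with
    | nil => rfl
    | cons a z => exact absurd h (key s a z hy')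
  | cons a y ih =>
    cases y' with
    | nil => exact absurd h.symm (key s a y hy)
    | cons b z =>
      simp only [raise] at h
      obtain ⟨h1, h2⟩ := List.cons.inj h
      have h3 : (pull s a).1 = (pull s b).1 := by
        rw [← carryOf_raise (pull s a).1 y, h2, carryOf_raise]
      rw [h3] at h2
      have h4 := push_pull s a
      rw [h1, h3, push_pull] at h4
      rw [ih hy.1 hy'.1 h2, (Prod.mk.inj h4).2]

theorem exists_raise_eq {x : List (ℕ × Bool)} (hx : Trimmed x) :
    ∃ s y, Trimmed y ∧ raise s y = x := by
  induction x with
  | nil => exact ⟨.none, [], trivial, rfl⟩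
  | cons a x ih =>
    obtain ⟨s, y, hy, rfl⟩ := ih hx.1
    by_cases h : y = [] ∧ (push s a).2 = (0, false)
    · obtain ⟨rfl, h⟩ := h
      refine ⟨(push s a).1, [], trivial, ?_⟩
      rcases s <;> rcases a with ⟨_ | _ | a, _ | _⟩ <;> simp_all [push, raise, Trimmed]
    · refine ⟨(push s a).1, (push s a).2 :: y, ⟨hy, fun h1 h2 => h ⟨h1, h2⟩⟩, ?_⟩
      simp [raise, pull_push]

theorem partCount_raise (s : Carry) (y : List (ℕ × Bool)) :
    partCount (raise s y) = partCount y + s.size := by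
  induction y generalizing s with
  | nil => cases s <;> rfl
  | cons a y ih =>
    have : mult (pull s a).2 + (pull s a).1.size = mult a + s.size := by
      rcases s <;> rcases a with ⟨_ | a, _ | _⟩ <;> simp [pull, mult, Carry.size]
    simp only [raise, partCount, ih]
    omega

theorem weight_raise (s : Carry) (y : List (ℕ × Bool)) :
    weight (raise s y) = weight y + blockLength (raise s y) := by
  induction y generalizing s with
  | nil => cases s <;> rfl
  | cons a y ih =>
    have : mult (pull s a).2 + (pull s a).1.size = mult a + s.size := by
      rcases s <;> rcases a with ⟨_ | a, _ | _⟩ <;> simp [pull, mult, Carry.size]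
    simp only [raise, weight, ih, blockLength, partCount_raise, carryOf_raise, push_pull]
    omega

theorem barCount_raise (s : Carry) (y : List (ℕ × Bool)) :
    barCount (raise s y) = barCount y + s.bars := by
  induction y generalizing s with
  | nil => cases s <;> rfl
  | cons a y ih =>
    have : (pull s a).2.2.toNat + (pull s a).1.bars = a.2.toNat + s.bars := by
      rcases s <;> rcases a with ⟨_ | a, _ | _⟩ <;> simp [pull, Carry.bars]
    simp only [raise, barCount, ih]
    omega

/-- The number of multuple positions lost in a scan with final carry `s`, when `t` is the
final carry of a second scan. -/
def lengthDrop : Carry → Carry → ℕ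
  | .none, _ => 0
  | .plain, .none => 1
  | .plain, _ => 0
  | .bar, _ => 1

theorem blockLength_raise (s : Carry) (y : List (ℕ × Bool)) :
    blockLength (raise s y) = blockLength y + lengthDrop s (carryOf y) := by
  induction y generalizing s with
  | nil => cases s <;> rfl
  | cons a y ih =>
    have : lengthDrop (pull s a).1 (carryOf y) + s.size =
        (push (carryOf y) a).1.size + lengthDrop s (push (carryOf y) a).1 := by
      rcases s <;> rcases carryOf y <;> rcases a with ⟨_ | a, _ | _⟩ <;>
        simp [pull, push, Carry.size, lengthDrop]
    simp only [raise, blockLength, ih, carryOf_raise, push_pull, carryOf]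
    omega

theorem blockLength_pos {x : List (ℕ × Bool)} (hx : Trimmed x) (h : x ≠ []) :
    0 < blockLength x := by
  induction x with
  | nil => exact absurd rfl h
  | cons a x ih =>
    by_cases h0 : x = []
    · subst h0
      have := hx.2 rfl
      rcases a with ⟨_ | a, _ | _⟩ <;> simp_all [blockLength, carryOf, push, Carry.size]
    · have := ih hx.1 h0
      simp only [blockLength]
      omega

/-- Compatibility between the numbers `a` and `b` of plain parts just before the sequences
`y` and `raise s y`. -/
def RaiseBound (K : ℕ) : Carry → ℕ → ℕ → Prop
  | .none, a, b => b ≤ a + 1 ∧ b ≤ K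
  | .plain, a, b => a = b + 1
  | .bar, a, b => a = b ∧ a + 1 ≤ K

theorem gap_raise {K : ℕ} {s : Carry} {a b : ℕ} {y : List (ℕ × Bool)} (hy : Gap K a y)
    (h : RaiseBound K s a b) : Gap K b (raise s y) := by
  induction y generalizing s a b with
  | nil =>
    cases s <;> simp only [Gap, raise, mult, RaiseBound, Bool.toNat_true, Bool.toNat_false] at * <;>
      omega
  | cons x y ih =>
    have h1 : b + mult (pull s x).2 ≤ K ∧ RaiseBound K (pull s x).1 x.1 (pull s x).2.1 := by
      have := hy.1
      rcases s <;> rcases x with ⟨_ | c, _ | _⟩ <;>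
        simp [pull, mult, RaiseBound] at this h ⊢ <;> omega
    rw [raise_cons]
    exact ⟨h1.1, ih hy.2 h1.2⟩

/-- Compatibility between the numbers `a` and `b` of plain parts just before the sequences
`y` and `raise s y`, for recovering the difference condition on `y`. -/
def LowerBound : Carry → ℕ → ℕ → Prop
  | .none, a, b => a + 1 ≤ b ∨ a = 0
  | .plain, a, b => a = b + 1
  | .bar, a, b => a = b

theorem gap_raise_size {K : ℕ} {s : Carry} {b : ℕ} {y : List (ℕ × Bool)}
    (h : Gap K b (raise s y)) : b + s.size ≤ K := by
  cases y with
  | nil =>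
    cases s <;> simp only [Gap, raise, mult, Carry.size, Bool.toNat_true, Bool.toNat_false] at * <;>
      omega
  | cons x y =>
    rw [raise_cons] at h
    have h1 := h.1
    have h2 := h.le
    rcases s <;> rcases x with ⟨_ | c, _ | _⟩ <;>
        simp only [pull, mult, Carry.size, Bool.toNat_true, Bool.toNat_false] at * <;> omega

theorem gap_of_gap_raise {K : ℕ} {s : Carry} {a b : ℕ} {y : List (ℕ × Bool)}
    (hy : Gap K b (raise s y)) (h : LowerBound s a b) : Gap K a y := by
  induction y generalizing s a b with
  | nil =>
    have := gap_raise_size hy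
    cases s <;> simp only [Gap, LowerBound, Carry.size] at * <;> omega
  | cons x y ih =>
    rw [raise_cons] at hy
    have h1 : a + mult x ≤ K ∧ LowerBound (pull s x).1 x.1 (pull s x).2.1 := by
      have h1 := hy.1
      have h2 := gap_raise_size hy.2
      rcases s <;> rcases x with ⟨_ | c, _ | _⟩ <;>
        simp [pull, mult, LowerBound, Carry.size] at h1 h2 h ⊢ <;> omega
    exact ⟨h1.1, ih hy.2 h1.2⟩

/-! ### Lattice paths -/

/-- Recursive description of the paths from height `h` that stay at height at most `K`. -/
inductive PathFrom (K : ℕ) : ℕ → List PStep → Prop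
  | nil : PathFrom K 0 []
  | se {h l} : h + 1 ≤ K → PathFrom K h l → PathFrom K (h + 1) (.SE :: l)
  | e {l} : l ≠ [] → PathFrom K 0 l → PathFrom K 0 (.E :: l)
  | ne {h l} : h + 1 ≤ K → PathFrom K (h + 1) l → PathFrom K h (.NE :: l)
  | nes {h l} : h + 1 ≤ K → PathFrom K h l → PathFrom K h (.NE :: .S :: l)

/-- The carry belonging to the first step of a path. -/
def firstCarry : List PStep → Carry
  | .NE :: .S :: _ => .bar
  | .NE :: _ => .plain
  | _ => .none

/-- The multiplicity sequence of a path. -/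
def pathMults : List PStep → List (ℕ × Bool)
  | [] => []
  | .S :: l => pathMults l
  | .NE :: l => raise (firstCarry (.NE :: l)) (pathMults l)
  | _ :: l => raise .none (pathMults l)

theorem PathFrom.firstCarry_ne {K h : ℕ} {l : List PStep} (hl : PathFrom K h l) :
    firstCarry (.NE :: l) = .plain := by
  cases hl <;> rfl

theorem PathFrom.carryOf {K h : ℕ} {l : List PStep} (hl : PathFrom K h l) :
    carryOf (pathMults l) = firstCarry l := by
  cases hl <;> simp only [pathMults, carryOf_raise] <;> rfl

/-- Indicator of a path starting with a descending step. -/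
def startsDown : List PStep → ℕ
  | .SE :: _ => 1
  | .S :: _ => 1
  | _ => 0

/-- Indicator of a peak directly after a first step `s`. -/
def peakAfter (s : PStep) (l : List PStep) : ℕ := if s = .NE then startsDown l else 0

theorem isPeak_zero (s : PStep) (l : List PStep) :
    (if IsPeak (s :: l) 0 then 1 else 0) = peakAfter s l := by
  rcases s <;> rcases l with _ | ⟨_ | _ | _ | _, l⟩ <;> simp [IsPeak, peakAfter, startsDown]

theorem isPeak_succ (s : PStep) (l : List PStep) (m : ℕ) :
    IsPeak (s :: l) (m + 1) ↔ IsPeak l m := by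
  simp [IsPeak]

theorem numPeaks_cons (s : PStep) (l : List PStep) :
    numPeaks (s :: l) = numPeaks l + peakAfter s l := by
  simp only [numPeaks, Finset.card_filter, List.length_cons, Finset.sum_range_succ', isPeak_succ,
    isPeak_zero]

theorem majorIndex_cons (s : PStep) (l : List PStep) :
    majorIndex (s :: l) = majorIndex l + stepDx s * numPeaks (s :: l) := by
  have h0 : (if IsPeak (s :: l) 0 then pathX ((s :: l).take 1) else 0) =
      stepDx s * peakAfter s l := by
    rw [← isPeak_zero]
    simp [pathX]
  rw [numPeaks_cons, majorIndex, List.length_cons, Finset.sum_range_succ', h0]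
  simp only [isPeak_succ, numPeaks, Finset.card_filter, majorIndex, mul_add, Finset.mul_sum,
    ← add_assoc, ← Finset.sum_add_distrib]
  congr 1
  refine Finset.sum_congr rfl fun m _ => ?_
  split <;> simp [pathX, add_comm _ (stepDx s)]

theorem trimmed_pathMults (l : List PStep) : Trimmed (pathMults l) := by
  induction l with
  | nil => trivial
  | cons s l ih => cases s <;> simp only [pathMults] <;> first | exact ih | exact trimmed_raise _ ih

theorem PathFrom.gap {K h : ℕ} {l : List PStep} (hl : PathFrom K h l) :
    Gap K h (pathMults l) := by
  induction hl with
  | nil => exact Nat.zero_le K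
  | se hK _ ih => exact gap_raise ih ⟨le_rfl, hK⟩
  | e _ _ ih => exact gap_raise ih ⟨Nat.zero_le _, Nat.zero_le _⟩
  | ne hK hl ih =>
    rw [pathMults, hl.firstCarry_ne]
    exact gap_raise ih rfl
  | nes hK _ ih => exact gap_raise ih ⟨rfl, hK⟩

theorem PathFrom.blockLength_eq {K h : ℕ} {l : List PStep} (hl : PathFrom K h l) :
    blockLength (pathMults l) = numPeaks l := by
  induction hl with
  | nil => rfl
  | se _ _ ih => simp [pathMults, blockLength_raise, ih, numPeaks_cons, lengthDrop, peakAfter]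
  | e _ _ ih => simp [pathMults, blockLength_raise, ih, numPeaks_cons, lengthDrop, peakAfter]
  | ne _ hl ih =>
    rw [pathMults, hl.firstCarry_ne, blockLength_raise, hl.carryOf, ih, numPeaks_cons]
    cases hl <;> rename_i l _ _ <;> first | rfl | (cases l <;> rfl) | skip
    rename_i l
    rcases l with _ | ⟨_ | _ | _ | _, l⟩ <;> rfl
  | nes _ _ ih =>
    simp [pathMults, blockLength_raise, ih, numPeaks_cons, lengthDrop, peakAfter, firstCarry,
      startsDown]

theorem PathFrom.weight_eq {K h : ℕ} {l : List PStep} (hl : PathFrom K h l) :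
    weight (pathMults l) = majorIndex l := by
  have key : ∀ {h l s y}, PathFrom K h l → pathMults l = raise s y →
      weight (pathMults l) = weight y + numPeaks l := by
    intro h l s y hl he
    rw [← hl.blockLength_eq, he, weight_raise]
  induction hl with
  | nil => rfl
  | se hK hl ih => rw [key (.se hK hl) rfl, ih, majorIndex_cons]; simp [stepDx]
  | e hK hl ih => rw [key (.e hK hl) rfl, ih, majorIndex_cons]; simp [stepDx]
  | ne hK hl ih => rw [key (.ne hK hl) rfl, ih, majorIndex_cons]; simp [stepDx]
  | nes hK hl ih =>
    rw [key (.nes hK hl) rfl, pathMults, ih, majorIndex_cons, majorIndex_cons .S]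
    simp [stepDx]

theorem southSteps_cons (s : PStep) (l : List PStep) :
    southSteps (s :: l) = southSteps l + if s = .S then 1 else 0 := by
  rw [southSteps, List.count_cons]
  cases s <;> rfl

theorem PathFrom.barCount_eq {K h : ℕ} {l : List PStep} (hl : PathFrom K h l) :
    barCount (pathMults l) = southSteps l := by
  induction hl with
  | nil => rfl
  | se _ _ ih => simp [pathMults, barCount_raise, southSteps_cons, ih, Carry.bars]
  | e _ _ ih => simp [pathMults, barCount_raise, southSteps_cons, ih, Carry.bars]
  | ne _ hl ih => simp [pathMults, hl.firstCarry_ne, barCount_raise, southSteps_cons, ih, Carry.bars]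
  | nes _ _ ih => simp [pathMults, barCount_raise, southSteps_cons, ih, Carry.bars, firstCarry]

theorem PathFrom.eq_nil {K : ℕ} {l : List PStep} (hl : PathFrom K 0 l)
    (h : pathMults l = []) : l = [] := by
  induction l with
  | nil => rfl
  | cons s l ih =>
    exfalso
    cases hl with
    | e hne hl => exact hne (ih hl (raise_none_eq_nil h).2)
    | ne hK hl =>
      rw [pathMults, hl.firstCarry_ne] at h
      exact Carry.noConfusion (raise_none_eq_nil h).1
    | nes hK hl => exact Carry.noConfusion (raise_none_eq_nil h).1

theorem PathFrom.injective {K h : ℕ} {l l' : List PStep} (hl : PathFrom K h l)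
    (hl' : PathFrom K h l') (he : pathMults l = pathMults l') : l = l' := by
  have hc : firstCarry l = firstCarry l' := by rw [← hl.carryOf, he, hl'.carryOf]
  induction hl generalizing l' with
  | nil => exact (hl'.eq_nil he.symm).symm
  | se _ hl ih =>
    cases hl' with
    | se _ hl' =>
      have he' := (raise_injective (trimmed_pathMults _) (trimmed_pathMults _) he).2
      rw [ih hl' he' (by rw [← hl.carryOf, he', hl'.carryOf])]
    | ne _ hl' => rw [hl'.firstCarry_ne] at hc; cases hc
    | nes _ hl' => cases hc
  | e hne hl ih =>
    cases hl' with
    | nil => exact (PathFrom.e hne hl).eq_nil he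
    | e _ hl' =>
      have he' := (raise_injective (trimmed_pathMults _) (trimmed_pathMults _) he).2
      rw [ih hl' he' (by rw [← hl.carryOf, he', hl'.carryOf])]
    | ne _ hl' => rw [hl'.firstCarry_ne] at hc; cases hc
    | nes _ hl' => cases hc
  | ne hK hl ih =>
    have hc' := hl.firstCarry_ne
    rw [hc'] at hc
    cases hl' with
    | nil => cases hc
    | se _ hl' => cases hc
    | e _ hl' => cases hc
    | ne _ hl' =>
      have he' := (raise_injective (trimmed_pathMults _) (trimmed_pathMults _) he).2
      rw [ih hl' he' (by rw [← hl.carryOf, he', hl'.carryOf])]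
    | nes _ hl' => cases hc
  | nes hK hl ih =>
    cases hl' with
    | nil => cases hc
    | se _ hl' => cases hc
    | e _ hl' => cases hc
    | ne _ hl' => rw [hl'.firstCarry_ne] at hc; cases hc
    | nes _ hl' =>
      have he' := (raise_injective (trimmed_pathMults _) (trimmed_pathMults _) he).2
      simp only [pathMults] at he'
      rw [ih hl' he' (by rw [← hl.carryOf, he', hl'.carryOf])]

theorem exists_pathFrom_nil {K h : ℕ} (hK : h ≤ K) :
    ∃ l, PathFrom K h l ∧ pathMults l = [] := by
  induction h with
  | zero => exact ⟨[], .nil, rfl⟩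
  | succ h ih =>
    obtain ⟨l, hl, he⟩ := ih (by omega)
    exact ⟨.SE :: l, .se hK hl, by simp [pathMults, he, raise]⟩

theorem exists_pathFrom {K h : ℕ} {x : List (ℕ × Bool)} (hx : Trimmed x) (hg : Gap K h x) :
    ∃ l, PathFrom K h l ∧ pathMults l = x := by
  induction hn : weight x using Nat.strong_induction_on generalizing x h with
  | _ n ih =>
    by_cases h0 : x = []
    · subst h0
      exact exists_pathFrom_nil hg
    have hpos := blockLength_pos hx h0
    obtain ⟨s, y, hy, rfl⟩ := exists_raise_eq hx
    have hlt : weight y < n := by rw [← hn, weight_raise]; omega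
    have hsize := gap_raise_size hg
    cases s with
    | none =>
      cases h with
      | zero =>
        obtain ⟨l, hl, rfl⟩ := ih _ hlt hy (gap_of_gap_raise (a := 0) hg (Or.inr rfl)) rfl
        refine ⟨.E :: l, .e ?_ hl, rfl⟩
        rintro rfl
        exact h0 rfl
      | succ h =>
        obtain ⟨l, hl, rfl⟩ := ih _ hlt hy (gap_of_gap_raise (a := h) hg (Or.inl le_rfl)) rfl
        exact ⟨.SE :: l, .se hsize hl, rfl⟩
    | plain =>
      obtain ⟨l, hl, rfl⟩ := ih _ hlt hy (gap_of_gap_raise (a := h + 1) hg rfl) rfl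
      exact ⟨.NE :: l, .ne hsize hl, by rw [pathMults, hl.firstCarry_ne]⟩
    | bar =>
      obtain ⟨l, hl, rfl⟩ := ih _ hlt hy (gap_of_gap_raise (a := h) hg rfl) rfl
      exact ⟨.NE :: .S :: l, .nes hsize hl, rfl⟩

theorem pathHeight_cons_ne (h : ℕ) (l : List PStep) :
    pathHeight h (.NE :: l) = pathHeight (h + 1) l := by
  simp [pathHeight, stepDy]; ring

theorem pathHeight_cons_se (h : ℕ) (l : List PStep) :
    pathHeight (h + 1) (.SE :: l) = pathHeight h l := by
  simp [pathHeight, stepDy]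

theorem pathHeight_cons_s (h : ℕ) (l : List PStep) :
    pathHeight (h + 1) (.S :: l) = pathHeight h l := by
  simp [pathHeight, stepDy]

theorem pathHeight_cons_e (h : ℕ) (l : List PStep) :
    pathHeight h (.E :: l) = pathHeight h l := by
  simp [pathHeight, stepDy]


theorem specialPath_of_pathFrom {K h : ℕ} {l : List PStep} (hl : PathFrom K h l) :
    ValidPath h l ∧ ∀ m, pathHeight h (l.take m) ≤ K := by
  induction hl with
  | nil => simp [ValidPath, pathHeight]
  | @se h l hK hl ih =>
    obtain ⟨⟨h1, h2, h3, h4, h5⟩, h6⟩ := ih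
    refine ⟨⟨fun m => ?_, fun m hm => ?_, fun m hm => ?_, ?_, ?_⟩, fun m => ?_⟩
    · cases m
      · simp [pathHeight]; omega
      · rw [List.take_succ_cons, pathHeight_cons_se]; exact h1 _
    · cases m
      · simp at hm
      · obtain ⟨m', rfl, hm'⟩ := h2 _ hm; exact ⟨m' + 1, rfl, hm'⟩
    · cases m
      · simp at hm
      · rw [List.take_succ_cons, pathHeight_cons_se]; exact h3 _ hm
    · rw [pathHeight_cons_se]; exact h4
    · cases l <;> simp_all
    · cases m
      · simp [pathHeight]; omega
      · rw [List.take_succ_cons, pathHeight_cons_se]; exact h6 _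
  | @e l hne hl ih =>
    obtain ⟨⟨h1, h2, h3, h4, h5⟩, h6⟩ := ih
    refine ⟨⟨fun m => ?_, fun m hm => ?_, fun m hm => ?_, ?_, ?_⟩, fun m => ?_⟩
    · cases m
      · simp [pathHeight]
      · rw [List.take_succ_cons, pathHeight_cons_e]; exact h1 _
    · cases m
      · simp at hm
      · obtain ⟨m', rfl, hm'⟩ := h2 _ hm; exact ⟨m' + 1, rfl, hm'⟩
    · cases m
      · simp [pathHeight]
      · rw [List.take_succ_cons, pathHeight_cons_e]; exact h3 _ hm
    · rw [pathHeight_cons_e]; exact h4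
    · cases l <;> simp_all
    · cases m
      · simp [pathHeight]
      · rw [List.take_succ_cons, pathHeight_cons_e]; exact h6 _
  | @ne h l hK hl ih =>
    obtain ⟨⟨h1, h2, h3, h4, h5⟩, h6⟩ := ih
    refine ⟨⟨fun m => ?_, fun m hm => ?_, fun m hm => ?_, ?_, ?_⟩, fun m => ?_⟩
    · cases m
      · simp [pathHeight]
      · rw [List.take_succ_cons, pathHeight_cons_ne]; exact h1 _
    · cases m
      · simp at hm
      · obtain ⟨m', rfl, hm'⟩ := h2 _ hm; exact ⟨m' + 1, rfl, hm'⟩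
    · cases m
      · simp at hm
      · rw [List.take_succ_cons, pathHeight_cons_ne]; exact h3 _ hm
    · rw [pathHeight_cons_ne]; exact h4
    · cases hl <;> simp_all
    · cases m
      · simp [pathHeight]; omega
      · rw [List.take_succ_cons, pathHeight_cons_ne]; exact h6 _
  | @nes h l hK hl ih =>
    obtain ⟨⟨h1, h2, h3, h4, h5⟩, h6⟩ := ih
    refine ⟨⟨fun m => ?_, fun m hm => ?_, fun m hm => ?_, ?_, ?_⟩, fun m => ?_⟩
    · rcases m with _ | _ | m
      · simp [pathHeight]
      · simp [pathHeight, stepDy]; omega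
      · rw [List.take_succ_cons, List.take_succ_cons, pathHeight_cons_ne, pathHeight_cons_s]
        exact h1 _
    · rcases m with _ | _ | m
      · simp at hm
      · exact ⟨0, rfl, rfl⟩
      · obtain ⟨m', rfl, hm'⟩ := h2 _ hm; exact ⟨m' + 2, rfl, hm'⟩
    · rcases m with _ | _ | m
      · simp at hm
      · simp at hm
      · rw [List.take_succ_cons, List.take_succ_cons, pathHeight_cons_ne, pathHeight_cons_s]
        exact h3 _ hm
    · rw [pathHeight_cons_ne, pathHeight_cons_s]; exact h4
    · cases l <;> simp_all
    · rcases m with _ | _ | m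
      · simp [pathHeight]; omega
      · simp [pathHeight, stepDy]; omega
      · rw [List.take_succ_cons, List.take_succ_cons, pathHeight_cons_ne, pathHeight_cons_s]
        exact h6 _

theorem pathFrom_of_specialPath {K : ℕ} : ∀ {h : ℕ} {l : List PStep}, ValidPath h l →
    (∀ m, pathHeight h (l.take m) ≤ K) → PathFrom K h l
  | h, [], ⟨_, _, _, h4, _⟩, _ => by
    obtain rfl : h = 0 := by simpa [pathHeight] using h4
    exact .nil
  | h, .S :: l, ⟨_, h2, _, _, _⟩, _ => by
    obtain ⟨m, hm, _⟩ := h2 0 rfl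
    omega
  | 0, .SE :: l, ⟨h1, _, _, _, _⟩, _ => by
    have := h1 1
    simp [pathHeight, stepDy] at this
  | h + 1, .SE :: l, ⟨h1, h2, h3, h4, h5⟩, h6 => by
    refine .se (by simpa [pathHeight] using h6 0) (pathFrom_of_specialPath
      ⟨fun m => ?_, fun m hm => ?_, fun m hm => ?_, ?_, ?_⟩ fun m => ?_)
    · simpa [pathHeight_cons_se] using h1 (m + 1)
    · obtain ⟨m', hm', he⟩ := h2 (m + 1) hm
      obtain rfl : m = m' := by omega
      cases m
      · simp at he
      · exact ⟨_, rfl, he⟩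
    · simpa [pathHeight_cons_se] using h3 (m + 1) hm
    · rwa [pathHeight_cons_se] at h4
    · cases l <;> simp_all
    · simpa [pathHeight_cons_se] using h6 (m + 1)
  | h, .E :: l, ⟨h1, h2, h3, h4, h5⟩, h6 => by
    obtain rfl : h = 0 := by simpa [pathHeight] using h3 0 rfl
    refine .e (by rintro rfl; simp at h5) (pathFrom_of_specialPath
      ⟨fun m => ?_, fun m hm => ?_, fun m hm => ?_, ?_, ?_⟩ fun m => ?_)
    · simpa [pathHeight_cons_e] using h1 (m + 1)
    · obtain ⟨m', hm', he⟩ := h2 (m + 1) hm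
      obtain rfl : m = m' := by omega
      cases m
      · simp at he
      · exact ⟨_, rfl, he⟩
    · simpa [pathHeight_cons_e] using h3 (m + 1) hm
    · rwa [pathHeight_cons_e] at h4
    · cases l <;> simp_all
    · simpa [pathHeight_cons_e] using h6 (m + 1)
  | h, .NE :: [], ⟨_, _, _, _, h5⟩, _ => by simp at h5
  | h, .NE :: s :: l, ⟨h1, h2, h3, h4, h5⟩, h6 => by
    by_cases hs : s = .S
    · subst hs
      refine .nes (by have := h6 1; simp [pathHeight, stepDy] at this; omega)
        (pathFrom_of_specialPath
          ⟨fun m => ?_, fun m hm => ?_, fun m hm => ?_, ?_, ?_⟩ fun m => ?_)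
      · simpa [pathHeight_cons_ne, pathHeight_cons_s] using h1 (m + 2)
      · obtain ⟨m', hm', he⟩ := h2 (m + 2) hm
        obtain rfl : m + 1 = m' := by omega
        cases m
        · simp at he
        · exact ⟨_, rfl, he⟩
      · simpa [pathHeight_cons_ne, pathHeight_cons_s] using h3 (m + 2) hm
      · rwa [pathHeight_cons_ne, pathHeight_cons_s] at h4
      · cases l <;> simp_all
      · simpa [pathHeight_cons_ne, pathHeight_cons_s] using h6 (m + 2)
    refine .ne (by have := h6 1; simp [pathHeight, stepDy] at this; omega)
      (pathFrom_of_specialPath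
        ⟨fun m => ?_, fun m hm => ?_, fun m hm => ?_, ?_, ?_⟩ fun m => ?_)
    · simpa [pathHeight_cons_ne] using h1 (m + 1)
    · obtain ⟨m', hm', he⟩ := h2 (m + 1) hm
      obtain rfl : m = m' := by omega
      cases m
      · simp_all
      · exact ⟨_, rfl, he⟩
    · simpa [pathHeight_cons_ne] using h3 (m + 1) hm
    · rwa [pathHeight_cons_ne] at h4
    · simp_all
    · simpa [pathHeight_cons_ne] using h6 (m + 1)

theorem specialPath_iff {k i : ℕ} (hi : 1 ≤ i) (hik : i ≤ k) (l : List PStep) :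
    SpecialPath k i l ↔ PathFrom (k - 1) (k - i) l := by
  have hk : ∀ z : ℤ, z < k ↔ z ≤ ((k - 1 : ℕ) : ℤ) := fun z => by omega
  simp only [SpecialPath, hk]
  exact ⟨fun h => pathFrom_of_specialPath h.1 h.2, specialPath_of_pathFrom⟩

/-! ### Overpartitions and their multiplicity sequences -/

/-- The order in which the parts of an overpartition are listed. -/
def PartOrder (x y : ℕ × Bool) : Prop := y.1 < x.1 ∨ (x.1 = y.1 ∧ x.2 = false)

instance : IsTrans (ℕ × Bool) PartOrder where
  trans a b c h1 h2 := by
    unfold PartOrder at *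
    rcases h1 with h1 | h1 <;> rcases h2 with h2 | h2
    · left; omega
    · left; omega
    · left; omega
    · right; exact ⟨h1.1.trans h2.1, h1.2⟩

theorem isOverpartition_iff (l : List (ℕ × Bool)) :
    IsOverpartition l ↔ (∀ p ∈ l, 1 ≤ p.1) ∧ l.Pairwise PartOrder := by
  rw [← List.isChain_iff_pairwise]
  rfl

/-- The occurrences of the part `v`. -/
def block (v : ℕ) (x : ℕ × Bool) : List (ℕ × Bool) :=
  List.replicate x.1 (v, false) ++ List.replicate x.2.toNat (v, true)

/-- The overpartition with a given multiplicity sequence, the first entry of which is the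
multiplicity of `v`. -/
def toOver : ℕ → List (ℕ × Bool) → List (ℕ × Bool)
  | _, [] => []
  | v, x :: xs => toOver (v + 1) xs ++ block v x

theorem fst_of_mem_block {v : ℕ} {x p : ℕ × Bool} (h : p ∈ block v x) : p.1 = v := by
  simp only [block, List.mem_append, List.mem_replicate] at h
  rcases h with h | h <;> simp [h.2]

theorem mem_toOver {v : ℕ} {x : List (ℕ × Bool)} {p : ℕ × Bool} (h : p ∈ toOver v x) :
    v ≤ p.1 ∧ p.1 < v + x.length := by
  induction x generalizing v with
  | nil => simp [toOver] at h
  | cons a x ih =>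
    rw [toOver, List.mem_append] at h
    rw [List.length_cons]
    rcases h with h | h
    · have := ih h; omega
    · have := fst_of_mem_block h; omega

theorem pairwise_block (v : ℕ) (x : ℕ × Bool) : (block v x).Pairwise PartOrder := by
  rw [block, List.pairwise_append]
  refine ⟨?_, ?_, ?_⟩
  · exact List.pairwise_replicate.2 (Or.inr (Or.inr ⟨rfl, rfl⟩))
  · exact List.pairwise_replicate.2 (Or.inl (Bool.toNat_le _))
  · intro p hp q hq
    rw [List.eq_of_mem_replicate hp, List.eq_of_mem_replicate hq]
    exact Or.inr ⟨rfl, rfl⟩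

theorem pairwise_toOver (v : ℕ) (x : List (ℕ × Bool)) : (toOver v x).Pairwise PartOrder := by
  induction x generalizing v with
  | nil => exact List.Pairwise.nil
  | cons a x ih =>
    rw [toOver, List.pairwise_append]
    refine ⟨ih _, pairwise_block v a, fun p hp q hq => Or.inl ?_⟩
    have := mem_toOver hp
    have := fst_of_mem_block hq
    omega

theorem isOverpartition_toOver (x : List (ℕ × Bool)) : IsOverpartition (toOver 1 x) :=
  (isOverpartition_iff _).2 ⟨fun _ hp => (mem_toOver hp).1, pairwise_toOver 1 x⟩

theorem count_block_self (v : ℕ) (x : ℕ × Bool) (b : Bool) :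
    (block v x).count (v, b) = bif b then x.2.toNat else x.1 := by
  cases b <;> simp [block, List.count_replicate]

theorem count_toOver (v m : ℕ) (x : List (ℕ × Bool)) (b : Bool) :
    (toOver v x).count (v + m, b) =
      bif b then (x.getD m (0, false)).2.toNat else (x.getD m (0, false)).1 := by
  induction x generalizing v m with
  | nil => cases b <;> simp [toOver]
  | cons a x ih =>
    rw [toOver, List.count_append]
    cases m with
    | zero =>
      have : (toOver (v + 1) x).count (v, b) = 0 :=
        List.count_eq_zero.2 fun h => by have := (mem_toOver h).1; simp at this
      simp [this, count_block_self]
    | succ m =>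
      have h : (block v a).count (v + (m + 1), b) = 0 :=
        List.count_eq_zero.2 fun h => by have := fst_of_mem_block h; simp at this
      rw [h, show v + (m + 1) = v + 1 + m by omega, ih]
      simp

theorem opWeight_toOver (v : ℕ) (x : List (ℕ × Bool)) :
    opWeight (toOver (v + 1) x) = weight x + v * partCount x := by
  induction x generalizing v with
  | nil => rfl
  | cons a x ih =>
    have h := ih (v + 1)
    simp only [opWeight] at h
    simp only [toOver, opWeight, List.map_append, List.sum_append, h, weight, partCount, block,
      List.map_replicate, List.sum_replicate, smul_eq_mul, mult]
    ring

theorem opOverlined_toOver (v : ℕ) (x : List (ℕ × Bool)) :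
    opOverlined (toOver v x) = barCount x := by
  induction x generalizing v with
  | nil => rfl
  | cons a x ih =>
    have h := ih (v + 1)
    simp only [opOverlined] at h
    simp [toOver, opOverlined, barCount, block, h, add_comm]

/-- The largest part. -/
def maxPart (l : List (ℕ × Bool)) : ℕ := (l.map Prod.fst).foldr max 0

theorem le_maxPart {l : List (ℕ × Bool)} {p : ℕ × Bool} (h : p ∈ l) : p.1 ≤ maxPart l := by
  induction l with
  | nil => simp at h
  | cons a l ih =>
    simp only [maxPart, List.map_cons, List.foldr_cons] at ih ⊢
    rcases List.mem_cons.1 h with rfl | h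
    · exact le_max_left _ _
    · exact (ih h).trans (le_max_right _ _)

theorem exists_eq_maxPart {l : List (ℕ × Bool)} (h : 0 < maxPart l) :
    ∃ p ∈ l, p.1 = maxPart l := by
  induction l with
  | nil => simp [maxPart] at h
  | cons a l ih =>
    have he : maxPart (a :: l) = max a.1 (maxPart l) := rfl
    rcases le_total (maxPart l) a.1 with h1 | h1
    · exact ⟨a, by simp, by rw [he, max_eq_left h1]⟩
    · rw [he, max_eq_right h1] at h ⊢
      obtain ⟨p, hp, hmax⟩ := ih h
      exact ⟨p, List.mem_cons_of_mem _ hp, hmax⟩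

/-- The multiplicity sequence of an overpartition. -/
def multsOf (l : List (ℕ × Bool)) : List (ℕ × Bool) :=
  (List.range (maxPart l)).map fun v => (l.count (v + 1, false), l.contains (v + 1, true))

theorem trimmed_of_getLast? {x : List (ℕ × Bool)} (h : x.getLast? ≠ some (0, false)) :
    Trimmed x := by
  induction x with
  | nil => trivial
  | cons a x ih =>
    cases x with
    | nil => simpa [Trimmed] using h
    | cons b x => exact ⟨ih (by simpa using h), by simp⟩

theorem trimmed_multsOf (l : List (ℕ × Bool)) : Trimmed (multsOf l) := by
  refine trimmed_of_getLast? fun h => ?_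
  obtain hM | ⟨M, hM⟩ : maxPart l = 0 ∨ ∃ M, maxPart l = M + 1 := by
    cases maxPart l <;> simp
  · simp [multsOf, hM] at h
  · obtain ⟨⟨w, b⟩, hp, hw⟩ := exists_eq_maxPart (l := l) (by omega)
    rw [hM] at hw
    subst hw
    simp [multsOf, hM, List.range_succ] at h
    cases b
    · exact List.count_eq_zero.1 h.1 hp
    · exact h.2 hp

theorem count_true_eq {l : List (ℕ × Bool)} (hl : l.Pairwise PartOrder) (v : ℕ) :
    l.count (v, true) = (l.contains (v, true)).toNat := by
  have h1 : l.count (v, true) ≤ 1 := by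
    have := hl.filter (· == (v, true))
    rw [List.filter_beq, List.pairwise_replicate] at this
    rcases this with h | h
    · exact h
    · simp [PartOrder] at h
  by_cases h : (v, true) ∈ l
  · have := List.count_pos_iff.2 h
    simp [h]; omega
  · simp [h, List.count_eq_zero.2 h]

theorem toOver_multsOf {l : List (ℕ × Bool)} (hl : IsOverpartition l) :
    toOver 1 (multsOf l) = l := by
  rw [isOverpartition_iff] at hl
  refine List.Perm.eq_of_pairwise (le := PartOrder) ?_ (pairwise_toOver _ _) hl.2 ?_
  · rintro ⟨a, b⟩ ⟨c, d⟩ _ _ h1 h2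
    simp only [PartOrder] at h1 h2
    have : a = c := by omega
    subst this
    simp_all
  · rw [List.perm_iff_count]
    rintro ⟨w, b⟩
    rcases w with _ | m
    · rw [List.count_eq_zero.2 fun h => ?_, List.count_eq_zero.2 fun h => ?_]
      · have := hl.1 _ h; simp at this
      · have := (mem_toOver h).1; simp at this
    · rw [add_comm m 1, count_toOver, add_comm 1 m]
      by_cases hm : m < maxPart l
      · cases b
        · simp [multsOf, List.getD_eq_getElem?_getD, hm]
        · rw [count_true_eq hl.2]
          simp [multsOf, List.getD_eq_getElem?_getD, hm]
      · rw [List.count_eq_zero.2 fun h => hm (Nat.lt_of_succ_le (le_maxPart h))]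
        cases b <;> simp [multsOf, List.getD_eq_getElem?_getD, hm]

theorem exists_mem_toOver {v : ℕ} {x : List (ℕ × Bool)} (hx : Trimmed x) (h : x ≠ []) :
    ∃ p ∈ toOver v x, p.1 + 1 = v + x.length := by
  induction x generalizing v with
  | nil => exact absurd rfl h
  | cons a x ih =>
    by_cases h0 : x = []
    · subst h0
      have := hx.2 rfl
      rcases a with ⟨_ | a, _ | _⟩ <;> simp_all [toOver, block]
    · obtain ⟨p, hp, hp'⟩ := ih (v := v + 1) hx.1 h0
      exact ⟨p, by simp [toOver, hp], by simp [hp']; omega⟩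

theorem maxPart_toOver {x : List (ℕ × Bool)} (hx : Trimmed x) :
    maxPart (toOver 1 x) = x.length := by
  apply le_antisymm
  · by_contra! h
    obtain ⟨p, hp, hp'⟩ := exists_eq_maxPart (l := toOver 1 x) (by omega)
    have := mem_toOver hp
    omega
  · by_cases h0 : x = []
    · simp [h0]
    · obtain ⟨p, hp, hp'⟩ := exists_mem_toOver (v := 1) hx h0
      have := le_maxPart hp
      omega

theorem multsOf_toOver {x : List (ℕ × Bool)} (hx : Trimmed x) : multsOf (toOver 1 x) = x := by
  apply List.ext_getElem
  · simp [multsOf, maxPart_toOver hx]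
  · intro m h1 h2
    have h3 := count_toOver 1 m x false
    have h4 := count_toOver 1 m x true
    rw [count_true_eq (pairwise_toOver _ _)] at h4
    simp only [cond_false, cond_true, List.getD_eq_getElem _ _ h2, add_comm 1 m] at h3 h4
    simp only [multsOf, List.getElem_map, List.getElem_range]
    have h5 : ∀ a b : Bool, a.toNat = b.toNat → a = b := by decide
    rw [h3, h5 _ _ h4]

theorem countP_fst (l : List (ℕ × Bool)) (v : ℕ) :
    l.countP (fun p => p.1 == v) = l.count (v, false) + l.count (v, true) := by
  induction l with
  | nil => rfl
  | cons a l ih =>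
    rcases a with ⟨w, _ | _⟩ <;> by_cases h : w = v <;>
      simp [ih, h] <;> omega

theorem msLenAux_reverse_append (x r : List (ℕ × Bool)) :
    msLenAux ((x.map fun a => (mult a, a.2)).reverse ++ r) =
      blockLength x + match carryOf x with
        | .none => msLenAux r
        | _ => msLenWalk r := by
  induction x generalizing r with
  | nil => simp [blockLength, carryOf]
  | cons a x ih =>
    simp only [List.map_cons, List.reverse_cons, List.append_assoc, List.singleton_append, ih,
      blockLength, carryOf]
    rcases carryOf x <;> rcases a with ⟨_ | a, _ | _⟩ <;>
      simp [push, mult, msLenAux, msLenWalk, Carry.size, add_assoc]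

theorem msLength_eq {l : List (ℕ × Bool)} (hl : IsOverpartition l) :
    msLength l = blockLength (multsOf l) := by
  rw [isOverpartition_iff] at hl
  have h0 : (((List.range (maxPart l + 1)).reverse).map fun v =>
      ((l.filter fun p => p.1 == v).length, l.contains (v, true))) =
      ((multsOf l).map fun a => (mult a, a.2)).reverse ++ [(0, false)] := by
    rw [List.map_reverse, List.range_succ_eq_map, List.map_cons, List.reverse_cons]
    congr 2
    · simp only [multsOf, List.map_map]
      refine List.map_congr_left fun v _ => ?_
      simp only [Function.comp, mult, Nat.succ_eq_add_one, ← count_true_eq hl.2,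
        ← List.countP_eq_length_filter, countP_fst]
    · simp only [← List.countP_eq_length_filter, countP_fst]
      have h : ∀ b, (0, b) ∉ l := fun b h => by have := hl.1 _ h; simp at this
      simp [List.count_eq_zero.2 (h _), h]
  change msLenAux (((List.range (maxPart l + 1)).reverse).map fun v =>
      ((l.filter fun p => p.1 == v).length, l.contains (v, true))) = _
  rw [h0, msLenAux_reverse_append]
  cases carryOf (multsOf l) <;> simp [msLenAux, msLenWalk]

theorem gapCond_window {k v : ℕ} {P Q R : List (ℕ × Bool)} (hk : 1 ≤ k)
    (hg : GapCond k (P ++ (Q ++ R)))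
    (hQ : ∀ p ∈ Q, p.1 ≤ v + 1 ∧ v + 2 ≤ p.1 + if p.2 then 1 else 2) : Q.length ≤ k - 1 := by
  by_contra! h
  have hmem : ∀ t, t < Q.length → (P ++ (Q ++ R)).getD (P.length + t) (0, false) ∈ Q := by
    intro t ht
    simp [List.getD_eq_getElem?_getD, List.getElem?_append, ht]
  have h1 := hg (P.length + (Q.length - k)) (by simp; omega)
  have h2 := hmem (Q.length - k) (by omega)
  have h3 := hmem (Q.length - 1) (by omega)
  rw [show P.length + (Q.length - k) + (k - 1) = P.length + (Q.length - 1) by omega] at h1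
  have h4 := (hQ _ h2).1
  have h5 := (hQ _ h3).2
  omega

theorem gap_of_gapCond {k v a : ℕ} {x R : List (ℕ × Bool)} (hk : 1 ≤ k) (ha : a ≤ k - 1)
    (hg : GapCond k (toOver (v + 1) x ++ (List.replicate a (v, false) ++ R))) :
    Gap (k - 1) a x := by
  induction x generalizing v a R with
  | nil => exact ha
  | cons b x ih =>
    have h1 : a + mult b ≤ k - 1 := by
      have := gapCond_window (v := v) (P := toOver (v + 1 + 1) x)
        (Q := block (v + 1) b ++ List.replicate a (v, false)) (R := R) hk
        (by simpa [toOver] using hg) (by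
          intro p hp
          rcases List.mem_append.1 hp with hp | hp
          · have := fst_of_mem_block hp
            split <;> omega
          · rw [List.eq_of_mem_replicate hp]
            simp)
      simp [block] at this
      rw [mult]
      omega
    refine ⟨h1, ih (v := v + 1) (a := b.1)
      (R := List.replicate b.2.toNat (v + 1, true) ++ (List.replicate a (v, false) ++ R)) ?_ ?_⟩
    · rw [mult] at h1; omega
    · simpa [toOver, block] using hg

theorem Gap.getD {K h : ℕ} {x : List (ℕ × Bool)} (hx : Gap K h x) (m : ℕ) :
    mult (x.getD m (0, false)) ≤ K ∧
      (x.getD m (0, false)).1 + mult (x.getD (m + 1) (0, false)) ≤ K := by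
  induction x generalizing h m with
  | nil => simp [mult]
  | cons a x ih =>
    have h1 := hx.1
    cases m with
    | succ m => simpa using ih hx.2 m
    | zero =>
      refine ⟨by simp; omega, ?_⟩
      cases x with
      | nil => have := hx.2; simpa [mult, Gap] using this
      | cons b x => simpa using hx.2.1

theorem le_countP_of_window {l : List (ℕ × Bool)} {p : ℕ × Bool → Bool} {m k : ℕ}
    (hm : m + k ≤ l.length) (h : ∀ t (ht : t < l.length), m ≤ t → t < m + k → p l[t]) :
    k ≤ l.countP p := by
  have h1 : ((l.drop m).take k).countP p = k := by
    rw [List.countP_eq_length.2]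
    · simp; omega
    · intro a ha
      obtain ⟨t, ht, rfl⟩ := List.mem_iff_getElem.1 ha
      simp at ht
      simp only [List.getElem_take, List.getElem_drop]
      exact h _ _ (by omega) (by omega)
  rw [← h1]
  exact ((List.take_sublist _ _).trans (List.drop_sublist _ _)).countP_le

theorem countP_window (l : List (ℕ × Bool)) (v : ℕ) :
    l.countP (fun p => p.1 == v + 1 || p == (v, false)) =
      l.count (v, false) + (l.count (v + 1, false) + l.count (v + 1, true)) := by
  rw [← countP_fst]
  induction l with
  | nil => rfl
  | cons a l ih =>
    rcases a with ⟨w, _ | _⟩ <;> by_cases h : w = v + 1 <;> by_cases h' : w = v <;>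
      simp [ih, h, h'] <;> omega

theorem gapCond_of_counts {k : ℕ} {l : List (ℕ × Bool)} (hk : 1 ≤ k)
    (hl : l.Pairwise PartOrder)
    (h1 : ∀ p ∈ l, l.count (p.1, false) + l.count (p.1, true) ≤ k - 1)
    (h2 : ∀ p ∈ l, l.count (p.1, false) +
      (l.count (p.1 + 1, false) + l.count (p.1 + 1, true)) ≤ k - 1) : GapCond k l := by
  intro m hm
  rw [List.getD_eq_getElem _ _ hm, List.getD_eq_getElem _ _ (show m < l.length by omega)]
  rw [List.pairwise_iff_getElem] at hl
  have hle : ∀ s t (hs : s < l.length) (ht : t < l.length), s ≤ t → l[t].1 ≤ l[s].1 := by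
    intro s t hs ht hst
    rcases hst.eq_or_lt with rfl | hst
    · rfl
    · rcases hl s t hs ht hst with h | h <;> omega
  by_contra! hlt
  cases hb : l[m + (k - 1)].2
  · have := le_countP_of_window (l := l) (m := m) (k := k)
      (p := fun p => p.1 == l[m + (k - 1)].1 + 1 || p == (l[m + (k - 1)].1, false)) (by omega) (by
        intro t ht h3 h4
        have h5 := hle m t (by omega) ht h3
        have h6 := hle t (m + (k - 1)) ht hm (by omega)
        simp only [hb, Bool.false_eq_true, if_false] at hlt
        simp only [Bool.or_eq_true, beq_iff_eq]
        by_cases h7 : l[t].1 = l[m + (k - 1)].1 + 1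
        · exact Or.inl h7
        · refine Or.inr (Prod.ext (by simp; omega) ?_)
          rcases (show t ≤ m + (k - 1) by omega).eq_or_lt with rfl | h8
          · exact hb
          · rcases hl t _ ht hm h8 with h | h
            · omega
            · exact h.2)
    rw [countP_window] at this
    have := h2 _ (List.getElem_mem hm)
    omega
  · have := le_countP_of_window (l := l) (m := m) (k := k)
      (p := fun p => p.1 == l[m + (k - 1)].1) (by omega) (by
        intro t ht h3 h4
        have h5 := hle m t (by omega) ht h3
        have h6 := hle t (m + (k - 1)) ht hm (by omega)
        simp only [hb, if_true] at hlt
        simp only [beq_iff_eq]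
        omega)
    rw [countP_fst] at this
    have := h1 _ (List.getElem_mem hm)
    omega

theorem bCond_toOver_iff {k i : ℕ} (hi : 1 ≤ i) (hik : i ≤ k) (x : List (ℕ × Bool)) :
    BCond k i (toOver 1 x) ↔ Gap (k - 1) (k - i) x := by
  have h0 : ((toOver 1 x).filter fun p => p.1 == 1).length = mult (x.getD 0 (0, false)) := by
    have h3 := count_toOver 1 0 x false
    have h4 := count_toOver 1 0 x true
    rw [← List.countP_eq_length_filter, countP_fst, mult]
    simpa using congrArg₂ (· + ·) h3 h4
  rw [BCond, h0]
  constructor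
  · rintro ⟨-, hg, h1⟩
    cases x with
    | nil => simp only [Gap]; omega
    | cons a x =>
      simp only [List.getD_cons_zero] at h1
      refine ⟨by omega, gap_of_gapCond (v := 1) (R := List.replicate a.2.toNat (1, true))
        (by omega) ?_ ?_⟩
      · rw [mult] at h1; omega
      · simpa [toOver, block] using hg
  · intro hg
    have hcount : ∀ m, (toOver 1 x).count (m + 1, false) + (toOver 1 x).count (m + 1, true) =
        mult (x.getD m (0, false)) := by
      intro m
      rw [add_comm m 1, count_toOver, count_toOver]
      rfl
    refine ⟨isOverpartition_toOver x, gapCond_of_counts (by omega) (pairwise_toOver _ _) ?_ ?_, ?_⟩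
    · rintro ⟨w, b⟩ hp
      obtain ⟨m, rfl⟩ : ∃ m, w = m + 1 := ⟨w - 1, by have := (mem_toOver hp).1; simp at this; omega⟩
      rw [hcount]
      exact (hg.getD m).1
    · rintro ⟨w, b⟩ hp
      obtain ⟨m, rfl⟩ : ∃ m, w = m + 1 := ⟨w - 1, by have := (mem_toOver hp).1; simp at this; omega⟩
      have h5 := count_toOver 1 m x false
      rw [add_comm 1 m, cond_false] at h5
      rw [hcount (m + 1), h5]
      exact (hg.getD m).2
    · cases x with
      | nil => simp [mult]
      | cons a x => have := hg.1; simp; omega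

/-- **Proposition 5.1.** The number of paths with major index `n`, `j` South steps and
`N` peaks satisfying the special `(k,i)`-conditions equals the number of
overpartitions counted by `B̄_{k,i}(n,j)` whose multiplicity sequence has length `N`. -/
theorem paths_multiplicities (k i n j N : ℕ) (hi : 1 ≤ i) (hik : i ≤ k) :
    Nat.card {l : List PStep // SpecialPath k i l ∧ majorIndex l = n ∧
        southSteps l = j ∧ numPeaks l = N} =
      Nat.card {l : List (ℕ × Bool) //
        BCond k i l ∧ opWeight l = n ∧ opOverlined l = j ∧ msLength l = N} := by
  have hpaths : Nat.card {l : List PStep // SpecialPath k i l ∧ majorIndex l = n ∧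
        southSteps l = j ∧ numPeaks l = N} =
      Nat.card {x : List (ℕ × Bool) // Trimmed x ∧ Gap (k - 1) (k - i) x ∧ weight x = n ∧
        barCount x = j ∧ blockLength x = N} := by
    refine Nat.card_eq_of_bijective (fun l => ⟨pathMults l.1, ?_⟩) ⟨?_, ?_⟩
    · obtain ⟨l, hl, h1, h2, h3⟩ := l
      rw [specialPath_iff hi hik] at hl
      exact ⟨trimmed_pathMults l, hl.gap, hl.weight_eq.trans h1, hl.barCount_eq.trans h2,
        hl.blockLength_eq.trans h3⟩
    · rintro ⟨l, hl, _⟩ ⟨l', hl', _⟩ he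
      rw [specialPath_iff hi hik] at hl hl'
      exact Subtype.ext (hl.injective hl' (congrArg Subtype.val he))
    · rintro ⟨x, hx, hg, h1, h2, h3⟩
      obtain ⟨l, hl, rfl⟩ := exists_pathFrom hx hg
      exact ⟨⟨l, (specialPath_iff hi hik l).2 hl, hl.weight_eq.symm.trans h1,
        hl.barCount_eq.symm.trans h2, hl.blockLength_eq.symm.trans h3⟩, rfl⟩
  rw [hpaths]
  have hstats : ∀ x, opWeight (toOver 1 x) = weight x := fun x => by
    simpa using opWeight_toOver 0 x
  refine Nat.card_eq_of_bijective (fun x => ⟨toOver 1 x.1, ?_⟩) ⟨?_, ?_⟩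
  · obtain ⟨x, hx, hg, h1, h2, h3⟩ := x
    refine ⟨(bCond_toOver_iff hi hik x).2 hg, (hstats x).trans h1,
      (opOverlined_toOver 1 x).trans h2, ?_⟩
    rw [msLength_eq (isOverpartition_toOver x), multsOf_toOver hx, h3]
  · rintro ⟨x, hx, _⟩ ⟨y, hy, _⟩ he
    refine Subtype.ext ?_
    have he' : toOver 1 x = toOver 1 y := congrArg Subtype.val he
    change x = y
    rw [← multsOf_toOver hx, he', multsOf_toOver hy]
  · rintro ⟨l, hl, h1, h2, h3⟩
    have hx := toOver_multsOf hl.1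
    refine ⟨⟨multsOf l, trimmed_multsOf l, ?_, ?_, ?_, ?_⟩, Subtype.ext hx⟩
    · rwa [← bCond_toOver_iff hi hik, hx]
    · rw [← hstats, hx, h1]
    · rw [← opOverlined_toOver 1, hx, h2]
    · rw [← msLength_eq hl.1, h3]

end Paper
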